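/- arXiv:2403.14512 — 6 statements merged into one kernel-verified Lean document; each statement's English description precedes it below -/
import Mathlib

section
/- Let H be a real Hilbert space, c ∈ H, r > 0, and let P be the metric projection onto the closed ball B(c,r), given by P(x) = x if ‖x − c‖ ≤ r and P(x) = c + (r/‖x − c‖) • (x − c) otherwise. Let x̄ ∈ H with ‖x̄ − c‖ = r and let w ∈ H, w ≠ 0. (1) If there exists δ > 0 such that ‖(x̄ + t w) − c‖ ≥ r for all t ∈ (0, δ), then the limit of (P(x̄ + t w) − P(x̄))/t as t → 0⁺ exists and equals w − (1/r²)⟨x̄ − c, w⟩ • (x̄ − c). (2) If there exists δ > 0 such that ‖(x̄ + t w) − c‖ < r for all t ∈ (0, δ), then the limit of (P(x̄ + t w) − P(x̄))/t as t → 0⁺ exists and equals w. -/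
open scoped RealInnerProductSpace

/-- Gâteaux directional derivatives of the metric projection onto the closed ball `B(c,r)`
at a boundary point `xbar` (‖xbar − c‖ = r), along a direction `w ≠ 0`:
(1) if `xbar + t w` stays outside the open ball for small `t > 0`, the directional
derivative is `w − (1/r²)⟪xbar − c, w⟫ • (xbar − c)`; (2) if it enters the open ball,
the directional derivative is `w`. -/
theorem metric_projection_ball_center_gateaux_boundary
    {H : Type*} [NormedAddCommGroup H] [InnerProductSpace ℝ H] [CompleteSpace H]
    (c : H) (r : ℝ) (hr : 0 < r)
    (P : H → H)
    (hP : ∀ x, P x = if ‖x - c‖ ≤ r then x else c + (r / ‖x - c‖) • (x - c))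
    (xbar : H) (hxbar : ‖xbar - c‖ = r) (w : H) (hw : w ≠ 0) :
    ((∃ δ > (0:ℝ), ∀ t ∈ Set.Ioo (0:ℝ) δ, r ≤ ‖(xbar + t • w) - c‖) →
      Filter.Tendsto (fun t : ℝ => t⁻¹ • (P (xbar + t • w) - P xbar))
        (nhdsWithin 0 (Set.Ioi 0))
        (nhds (w - ((1 / r ^ 2) * ⟪xbar - c, w⟫) • (xbar - c)))) ∧
    ((∃ δ > (0:ℝ), ∀ t ∈ Set.Ioo (0:ℝ) δ, ‖(xbar + t • w) - c‖ < r) →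
      Filter.Tendsto (fun t : ℝ => t⁻¹ • (P (xbar + t • w) - P xbar))
        (nhdsWithin 0 (Set.Ioi 0)) (nhds w)) := by
  have hPx : P xbar = xbar := by rw [hP, if_pos hxbar.le]
  constructor
  · rintro ⟨δ, hδ, h⟩
    have hrn : r ≠ 0 := hr.ne'
    have hf : HasDerivAt (fun t : ℝ => (xbar + t • w) - c) w 0 := by
      have h1 := (((hasDerivAt_id (0:ℝ)).smul_const w).const_add xbar).sub_const c
      simpa using h1
    have hsq := hf.norm_sq
    have hn : HasDerivAt (fun t : ℝ => ‖(xbar + t • w) - c‖) (⟪xbar - c, w⟫ / r) 0 := by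
      have h2 := hsq.sqrt (by simp [hxbar, hrn])
      simp only [Real.sqrt_sq (norm_nonneg _)] at h2
      convert h2 using 1
      simp only [zero_smul, add_zero, hxbar]
      field_simp
    have hg : HasDerivAt (fun t : ℝ => c + (r / ‖(xbar + t • w) - c‖) • ((xbar + t • w) - c))
        (w - ((1 / r ^ 2) * ⟪xbar - c, w⟫) • (xbar - c)) 0 := by
      have h3 := ((((hasDerivAt_const (0:ℝ) r).fun_div hn (by simp [hxbar, hrn])).fun_smul hf).const_add c)
      convert h3 using 1
      simp only [zero_smul, add_zero, hxbar, div_self hrn, one_smul]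
      rw [sub_eq_add_neg, ← neg_smul]
      congr 2
      field_simp
      ring
    refine hg.tendsto_slope_zero_right.congr' ?_
    filter_upwards [Ioo_mem_nhdsGT hδ] with t ht
    have hr' := h t ht
    rw [hPx, hP]
    simp only [zero_add, zero_smul, add_zero, hxbar, div_self hrn, one_smul, add_sub_cancel]
    split_ifs with h4
    · rw [le_antisymm h4 hr', div_self hrn, one_smul, add_sub_cancel]
    · rfl
  · rintro ⟨δ, hδ, h⟩
    refine tendsto_const_nhds.congr' ?_
    filter_upwards [Ioo_mem_nhdsGT hδ] with t ht
    rw [hPx, hP, if_pos (h t ht).le, add_sub_cancel_left, smul_smul, inv_mul_cancel₀ ht.1.ne', one_smul]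
end

section
/- Let H be a real Hilbert space, c ∈ H, r > 0, and let P be the metric projection onto the closed ball B(c,r), given by P(x) = x if ‖x − c‖ ≤ r and P(x) = c + (r/‖x − c‖) • (x − c) otherwise. Then for every x̄ ∈ H with ‖x̄ − c‖ = r, P is not Fréchet differentiable at x̄: there is no continuous linear map A : H → H with ‖P(x̄+h) − P(x̄) − A h‖/‖h‖ → 0 as h → 0. -/
/-- The metric projection onto the closed ball `B(c,r)` in a real Hilbert space is not
Fréchet differentiable at any boundary point. -/
theorem metric_projection_ball_center_not_fderiv_boundary
    {H : Type*} [NormedAddCommGroup H] [InnerProductSpace ℝ H] [CompleteSpace H]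
    (c : H) (r : ℝ) (hr : 0 < r)
    (P : H → H)
    (hP : ∀ x, P x = if ‖x - c‖ ≤ r then x else c + (r / ‖x - c‖) • (x - c))
    (xbar : H) (hxbar : ‖xbar - c‖ = r) :
    ¬ ∃ A : H →L[ℝ] H, HasFDerivAt P A xbar := by
  rintro ⟨A, hA⟩
  obtain ⟨v, rfl⟩ : ∃ v, xbar = c + v := ⟨xbar - c, by abel⟩
  have hv : ‖v‖ = r := by simpa using hxbar
  have hnorm : ∀ t : ℝ, -1 ≤ t → ‖c + v + t • v - c‖ = (1 + t) * r := by
    intro t ht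
    have : c + v + t • v - c = (1 + t) • v := by module
    rw [this, norm_smul, hv, Real.norm_of_nonneg (by linarith)]
  have hline : HasDerivAt (fun t : ℝ => c + v + t • v) v 0 := by
    simpa using ((hasDerivAt_id (0 : ℝ)).smul_const v).const_add (c + v)
  have hg : HasDerivAt (fun t : ℝ => P (c + v + t • v)) (A v) 0 := by
    have hA' : HasFDerivAt P A (c + v + (0 : ℝ) • v) := by simpa using hA
    exact hA'.comp_hasDerivAt (0 : ℝ) hline
  have hin : ∀ t : ℝ, -1 ≤ t → t ≤ 0 → P (c + v + t • v) = c + v + t • v := by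
    intro t h1 h2
    rw [hP, if_pos]
    rw [hnorm t h1]
    nlinarith
  have hout : ∀ t : ℝ, 0 ≤ t → P (c + v + t • v) = c + v := by
    intro t h
    rcases h.eq_or_lt with rfl | h
    · simpa using hin 0 (by norm_num) le_rfl
    · rw [hP, if_neg]
      · rw [hnorm t (by linarith)]
        have : c + v + t • v - c = (1 + t) • v := by module
        rw [this, smul_smul]
        have : r / ((1 + t) * r) * (1 + t) = 1 := by
          have : 1 + t ≠ 0 := by linarith
          field_simp
        rw [this, one_smul]
      · rw [hnorm t (by linarith)]
        nlinarith
  have e1 : A v = 0 := by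
    have h1 := hg.hasDerivWithinAt (s := Set.Ici 0)
    have h2 : HasDerivWithinAt (fun t : ℝ => P (c + v + t • v)) 0 (Set.Ici 0) 0 :=
      (hasDerivWithinAt_const (0 : ℝ) (Set.Ici 0) (c + v)).congr
        (fun t ht => hout t ht) (hout 0 le_rfl)
    exact (uniqueDiffOn_Ici (0 : ℝ) 0 Set.self_mem_Ici).eq_deriv _ h1 h2
  have e2 : A v = v := by
    have h1 := hg.hasDerivWithinAt (s := Set.Icc (-1) 0)
    have h2 : HasDerivWithinAt (fun t : ℝ => P (c + v + t • v)) v (Set.Icc (-1) 0) 0 :=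
      hline.hasDerivWithinAt.congr
        (fun t ht => hin t ht.1 ht.2) (hin 0 (by norm_num) le_rfl)
    exact (uniqueDiffOn_Icc (by norm_num : (-1 : ℝ) < 0) 0 (by simp)).eq_deriv _ h1 h2
  rw [e1] at e2
  rw [← e2, norm_zero] at hv
  linarith
end

section
/- Let n ≥ 1, E = EuclideanSpace ℝ (Fin n), and let P : ℝ × E → ℝ × E be the metric projection onto the second-order cone K = {(z₁, z₂) : ‖z₂‖ ≤ z₁}, given by P(z) = z if ‖z₂‖ ≤ z₁; P(z) = 0 if z₁ ≤ −‖z₂‖; and P(z) = ((z₁ + ‖z₂‖)/2) • (1, z₂/‖z₂‖) otherwise. Then P is strictly Fréchet differentiable at every point z with |z₁| < ‖z₂‖, and, writing z̄₂ = z₂/‖z₂‖, its strict Fréchet derivative there is the continuous linear map (h₁, h₂) ↦ ( (h₁ + ⟨z̄₂, h₂⟩)/2 , (1/2)(1 + z₁/‖z₂‖) • h₂ + (h₁/2) • z̄₂ − (z₁/(2‖z₂‖)) ⟨z̄₂, h₂⟩ • z̄₂ ). -/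
open scoped RealInnerProductSpace

/-- The metric projection onto the second-order cone is strictly Fréchet differentiable
at every point `z` with `|z₁| < ‖z₂‖`, with the explicit derivative
`(h₁, h₂) ↦ ((h₁ + ⟪z̄₂, h₂⟫)/2,
  (1/2)(1 + z₁/‖z₂‖) • h₂ + (h₁/2) • z̄₂ − (z₁/(2‖z₂‖)) ⟪z̄₂, h₂⟫ • z̄₂)`
where `z̄₂ = z₂/‖z₂‖`. -/
theorem metric_projection_secondOrderCone_strictFDeriv_outside
    (n : ℕ) (hn : 1 ≤ n)
    (P : ℝ × EuclideanSpace ℝ (Fin n) → ℝ × EuclideanSpace ℝ (Fin n))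
    (hP : ∀ z, P z =
      if ‖z.2‖ ≤ z.1 then z
      else if z.1 ≤ -‖z.2‖ then 0
      else ((z.1 + ‖z.2‖) / 2) • ((1 : ℝ), ‖z.2‖⁻¹ • z.2))
    (z : ℝ × EuclideanSpace ℝ (Fin n)) (hz : |z.1| < ‖z.2‖) :
    ∃ A : ℝ × EuclideanSpace ℝ (Fin n) →L[ℝ] ℝ × EuclideanSpace ℝ (Fin n),
      (∀ h : ℝ × EuclideanSpace ℝ (Fin n),
        A h = ((h.1 + ⟪‖z.2‖⁻¹ • z.2, h.2⟫) / 2,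
          ((1 / 2) * (1 + z.1 / ‖z.2‖)) • h.2 + (h.1 / 2) • (‖z.2‖⁻¹ • z.2)
            - ((z.1 / (2 * ‖z.2‖)) * ⟪‖z.2‖⁻¹ • z.2, h.2⟫) • (‖z.2‖⁻¹ • z.2))) ∧
      HasStrictFDerivAt P A z := by
  have hr : 0 < ‖z.2‖ := lt_of_le_of_lt (abs_nonneg _) hz
  have hsq : HasStrictFDerivAt (fun w : ℝ × EuclideanSpace ℝ (Fin n) => ‖w.2‖ ^ 2)
      ((2 • innerSL ℝ z.2).comp (ContinuousLinearMap.snd ℝ ℝ (EuclideanSpace ℝ (Fin n)))) z :=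
    (hasStrictFDerivAt_norm_sq z.2).comp z hasStrictFDerivAt_snd
  have hN := hsq.sqrt (by positivity)
  simp only [Real.sqrt_sq (norm_nonneg _)] at hN
  have h1 : HasStrictFDerivAt (fun w : ℝ × EuclideanSpace ℝ (Fin n) => w.1)
      (ContinuousLinearMap.fst ℝ ℝ (EuclideanSpace ℝ (Fin n))) z :=
    hasStrictFDerivAt_fst
  have h2 : HasStrictFDerivAt (fun w : ℝ × EuclideanSpace ℝ (Fin n) => w.2)
      (ContinuousLinearMap.snd ℝ ℝ (EuclideanSpace ℝ (Fin n))) z :=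
    hasStrictFDerivAt_snd
  have hI := (hasStrictDerivAt_inv hr.ne').comp_hasStrictFDerivAt z hN
  have hc := (h1.add hN).mul_const (2⁻¹ : ℝ)
  have hG := hc.smul ((hasStrictFDerivAt_const (1 : ℝ) z).prodMk (hI.smul h2))
  refine ⟨_, ?_, hG.congr_of_eventuallyEq ?_⟩
  · intro h
    have hr' := hr.ne'
    ext i
    · simp [inner_smul_left]
      field_simp
    · simp [inner_smul_left]
      field_simp
      ring
  · have hz' := abs_lt.1 hz
    have e1 : ∀ᶠ w in nhds z, w.1 < ‖w.2‖ :=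
      (continuous_fst.continuousAt).eventually_lt (continuous_snd.norm.continuousAt) hz'.2
    have e2 : ∀ᶠ w in nhds z, -‖w.2‖ < w.1 :=
      (continuous_snd.norm.neg.continuousAt).eventually_lt (continuous_fst.continuousAt) hz'.1
    filter_upwards [e1, e2] with w hw1 hw2
    rw [hP, if_neg (not_le.2 hw1), if_neg (not_le.2 hw2)]
    simp [div_eq_mul_inv]
end

section
/- Let n ≥ 1, E = EuclideanSpace ℝ (Fin n), and let P : ℝ × E → ℝ × E be the metric projection onto the second-order cone K = {(z₁, z₂) : ‖z₂‖ ≤ z₁}, given by P(z) = z if ‖z₂‖ ≤ z₁; P(z) = 0 if z₁ ≤ −‖z₂‖; and P(z) = ((z₁ + ‖z₂‖)/2) • (1, z₂/‖z₂‖) otherwise. Let z = (z₁, z₂) with z₁ = ‖z₂‖ and z ≠ 0, and set z̄₂ = z₂/‖z₂‖. Then for every h = (h₁, h₂) ∈ ℝ × E, the limit of (P(z + t h) − P(z))/t as t → 0⁺ exists and equals h − min( (h₁ − ⟨z̄₂, h₂⟩)/2 , 0 ) • (1, −z̄₂). -/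
open scoped RealInnerProductSpace

/-- Gâteaux directional derivative of the metric projection onto the second-order cone at
a nonzero boundary point `z` of `K` (with `z₁ = ‖z₂‖`), along any direction `h`:
it equals `h − min((h₁ − ⟪z̄₂, h₂⟫)/2, 0) • (1, −z̄₂)` where `z̄₂ = z₂/‖z₂‖`. -/
theorem metric_projection_secondOrderCone_gateaux_boundary
    (n : ℕ) (hn : 1 ≤ n)
    (P : ℝ × EuclideanSpace ℝ (Fin n) → ℝ × EuclideanSpace ℝ (Fin n))
    (hP : ∀ z, P z =
      if ‖z.2‖ ≤ z.1 then z
      else if z.1 ≤ -‖z.2‖ then 0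
      else ((z.1 + ‖z.2‖) / 2) • ((1 : ℝ), ‖z.2‖⁻¹ • z.2))
    (z : ℝ × EuclideanSpace ℝ (Fin n)) (hz1 : z.1 = ‖z.2‖) (hz0 : z ≠ 0)
    (h : ℝ × EuclideanSpace ℝ (Fin n)) :
    Filter.Tendsto (fun t : ℝ => t⁻¹ • (P (z + t • h) - P z))
      (nhdsWithin 0 (Set.Ioi 0))
      (nhds (h - min ((h.1 - ⟪‖z.2‖⁻¹ • z.2, h.2⟫) / 2) 0 •
        ((1 : ℝ), -(‖z.2‖⁻¹ • z.2)))) := by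
  have hz2 : z.2 ≠ 0 := by
    intro h0
    apply hz0
    ext1
    · simp [hz1, h0]
    · simpa using h0
  have hr : 0 < ‖z.2‖ := norm_pos_iff.mpr hz2
  -- derivative of the norm along the line
  have hline : HasDerivAt (fun t : ℝ => z.2 + t • h.2) h.2 0 := by
    simpa using ((hasDerivAt_id (0 : ℝ)).smul_const h.2).const_add z.2
  have hnorm : HasDerivAt (fun t : ℝ => ‖z.2 + t • h.2‖) (⟪‖z.2‖⁻¹ • z.2, h.2⟫) 0 := by
    have h1 := hline.norm_sq
    have h2 := h1.sqrt (by simpa using hz2)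
    have h3 : (fun t : ℝ => √(‖z.2 + t • h.2‖ ^ 2)) = fun t : ℝ => ‖z.2 + t • h.2‖ := by
      funext t
      exact Real.sqrt_sq (norm_nonneg _)
    rw [h3] at h2
    convert h2 using 1
    simp only [zero_smul, add_zero, Real.sqrt_sq (norm_nonneg z.2), real_inner_smul_left]
    field_simp
  have hg : HasDerivAt (fun t : ℝ => (z.1 + t * h.1) - ‖z.2 + t • h.2‖)
      (h.1 - ⟪‖z.2‖⁻¹ • z.2, h.2⟫) 0 := by
    have h1 : HasDerivAt (fun t : ℝ => z.1 + t * h.1) h.1 0 := by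
      simpa using ((hasDerivAt_id (0 : ℝ)).mul_const h.1).const_add z.1
    exact h1.sub hnorm
  have hslope : Filter.Tendsto
      (fun t : ℝ => t⁻¹ * ((z.1 + t * h.1) - ‖z.2 + t • h.2‖))
      (nhdsWithin 0 (Set.Ioi 0)) (nhds (h.1 - ⟪‖z.2‖⁻¹ • z.2, h.2⟫)) := by
    have := hg.tendsto_slope_zero_right
    simpa [hz1] using this
  have hc2 : Filter.Tendsto (fun t : ℝ => z.2 + t • h.2) (nhdsWithin 0 (Set.Ioi 0))
      (nhds z.2) := by
    have := hline.continuousAt.tendsto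
    simp only [zero_smul, add_zero] at this
    exact this.mono_left nhdsWithin_le_nhds
  have hc1 : Filter.Tendsto (fun t : ℝ => z.1 + t * h.1) (nhdsWithin 0 (Set.Ioi 0))
      (nhds z.1) := by
    have : Continuous fun t : ℝ => z.1 + t * h.1 := by fun_prop
    have := this.tendsto 0
    simp only [zero_mul, add_zero] at this
    exact this.mono_left nhdsWithin_le_nhds
  have hsum : ∀ᶠ t : ℝ in nhdsWithin 0 (Set.Ioi 0),
      0 < (z.1 + t * h.1) + ‖z.2 + t • h.2‖ :=
    (hc1.add hc2.norm).eventually (lt_mem_nhds (by linarith))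
  have hne : ∀ᶠ t : ℝ in nhdsWithin 0 (Set.Ioi 0), 0 < ‖z.2 + t • h.2‖ :=
    hc2.norm.eventually (lt_mem_nhds hr)
  have hPz : P z = z := by rw [hP, if_pos hz1.ge]
  have hlim : Filter.Tendsto
      (fun t : ℝ => h - min ((t⁻¹ * ((z.1 + t * h.1) - ‖z.2 + t • h.2‖)) / 2) 0 •
        ((1 : ℝ), -(‖z.2 + t • h.2‖⁻¹ • (z.2 + t • h.2))))
      (nhdsWithin 0 (Set.Ioi 0))
      (nhds (h - min ((h.1 - ⟪‖z.2‖⁻¹ • z.2, h.2⟫) / 2) 0 •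
        ((1 : ℝ), -(‖z.2‖⁻¹ • z.2)))) := by
    refine tendsto_const_nhds.sub (Filter.Tendsto.smul ?_ ?_)
    · exact (hslope.div_const 2).min tendsto_const_nhds
    · exact tendsto_const_nhds.prodMk_nhds ((hc2.norm.inv₀ hr.ne').smul hc2).neg
  refine hlim.congr' ?_
  filter_upwards [hsum, hne, self_mem_nhdsWithin] with t h1 h2 ht
  have ht : 0 < t := ht
  rw [hPz, hP]
  simp only [Prod.fst_add, Prod.snd_add, Prod.smul_fst, Prod.smul_snd, smul_eq_mul]
  by_cases hc : ‖z.2 + t • h.2‖ ≤ z.1 + t * h.1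
  · rw [if_pos hc, min_eq_right (by have : 0 ≤ z.1 + t * h.1 - ‖z.2 + t • h.2‖ := by linarith
                                    positivity)]
    rw [add_sub_cancel_left, inv_smul_smul₀ ht.ne']
    simp
  · rw [if_neg hc, if_neg (by linarith), min_eq_left (by
      have : z.1 + t * h.1 - ‖z.2 + t • h.2‖ ≤ 0 := by linarith
      have := mul_nonpos_of_nonneg_of_nonpos (inv_pos.mpr ht).le this
      linarith)]
    have key : ∀ (w : EuclideanSpace ℝ (Fin n)) (r : ℝ), 0 < r → w = z.2 + t • h.2 →
        h - (t⁻¹ * (z.1 + t * h.1 - r) / 2) • ((1 : ℝ), -(r⁻¹ • w)) =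
        t⁻¹ • (((z.1 + t * h.1 + r) / 2) • ((1 : ℝ), r⁻¹ • w) - z) := by
      intro w r hr hw
      ext1
      · simp
        field_simp
        ring
      · have hh : h.2 = t⁻¹ • (w - z.2) := by
          rw [hw, add_sub_cancel_left, inv_smul_smul₀ ht.ne']
        simp only [Prod.snd_sub, Prod.smul_snd]
        rw [hh]
        match_scalars <;> field_simp <;> ring
    exact key _ _ h2 rfl
end

section
/- Let n ≥ 1, E = EuclideanSpace ℝ (Fin n), and let P : ℝ × E → ℝ × E be the metric projection onto the second-order cone K = {(z₁, z₂) : ‖z₂‖ ≤ z₁}, given by P(z) = z if ‖z₂‖ ≤ z₁; P(z) = 0 if z₁ ≤ −‖z₂‖; and P(z) = ((z₁ + ‖z₂‖)/2) • (1, z₂/‖z₂‖) otherwise. Let z = (z₁, z₂) with z₁ = −‖z₂‖ and z ≠ 0, and set z̄₂ = z₂/‖z₂‖. Then for every h = (h₁, h₂) ∈ ℝ × E, the limit of (P(z + t h) − P(z))/t as t → 0⁺ exists and equals max( (h₁ + ⟨z̄₂, h₂⟩)/2 , 0 ) • (1, z̄₂). -/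
open scoped RealInnerProductSpace

/-- Gâteaux directional derivative of the metric projection onto the second-order cone at
a nonzero boundary point `z` of `−K` (with `z₁ = −‖z₂‖`), along any direction `h`:
it equals `max((h₁ + ⟪z̄₂, h₂⟫)/2, 0) • (1, z̄₂)` where `z̄₂ = z₂/‖z₂‖`. -/
theorem metric_projection_secondOrderCone_gateaux_neg_boundary
    (n : ℕ) (hn : 1 ≤ n)
    (P : ℝ × EuclideanSpace ℝ (Fin n) → ℝ × EuclideanSpace ℝ (Fin n))
    (hP : ∀ z, P z =
      if ‖z.2‖ ≤ z.1 then z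
      else if z.1 ≤ -‖z.2‖ then 0
      else ((z.1 + ‖z.2‖) / 2) • ((1 : ℝ), ‖z.2‖⁻¹ • z.2))
    (z : ℝ × EuclideanSpace ℝ (Fin n)) (hz1 : z.1 = -‖z.2‖) (hz0 : z ≠ 0)
    (h : ℝ × EuclideanSpace ℝ (Fin n)) :
    Filter.Tendsto (fun t : ℝ => t⁻¹ • (P (z + t • h) - P z))
      (nhdsWithin 0 (Set.Ioi 0))
      (nhds (max ((h.1 + ⟪‖z.2‖⁻¹ • z.2, h.2⟫) / 2) 0 •
        ((1 : ℝ), ‖z.2‖⁻¹ • z.2))) := by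
  have hz2 : z.2 ≠ 0 := by
    intro h0
    apply hz0
    ext1
    · simp [hz1, h0]
    · simp [h0]
  have hpos : 0 < ‖z.2‖ := norm_pos_iff.mpr hz2
  have hd0 : HasDerivAt (fun t : ℝ => z.2 + t • h.2) h.2 0 := by
    simpa using ((hasDerivAt_id (0 : ℝ)).smul_const h.2).const_add z.2
  have hd : HasDerivAt (fun t : ℝ => ‖z.2 + t • h.2‖) (⟪‖z.2‖⁻¹ • z.2, h.2⟫) 0 := by
    have h1 := hd0.norm_sq
    have h2 := h1.sqrt (by simpa using hz2)
    simp only [norm_nonneg, Real.sqrt_sq] at h2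
    convert h2 using 1
    simp only [zero_smul, add_zero, real_inner_smul_left]
    field_simp
  have hPz : P z = 0 := by
    rw [hP, if_neg (by linarith), if_pos hz1.le]
  have hlim : Filter.Tendsto (fun t : ℝ => t⁻¹ * (‖z.2 + t • h.2‖ - ‖z.2‖))
      (nhdsWithin 0 (Set.Ioi 0)) (nhds (⟪‖z.2‖⁻¹ • z.2, h.2⟫)) := by
    have := hd.tendsto_slope_zero_right
    simpa using this
  have hc0 : Filter.Tendsto (fun t : ℝ => z.2 + t • h.2)
      (nhdsWithin 0 (Set.Ioi 0)) (nhds z.2) := by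
    have := hd0.continuousAt.tendsto
    simp only [zero_smul, add_zero] at this
    exact this.mono_left nhdsWithin_le_nhds
  have hc1 : Filter.Tendsto (fun t : ℝ => z.1 + t * h.1)
      (nhdsWithin 0 (Set.Ioi 0)) (nhds z.1) := by
    have : Continuous (fun t : ℝ => z.1 + t * h.1) := by fun_prop
    have := this.tendsto 0
    simp only [zero_mul, add_zero] at this
    exact this.mono_left nhdsWithin_le_nhds
  have hvec : Filter.Tendsto
      (fun t : ℝ => ((1 : ℝ), ‖z.2 + t • h.2‖⁻¹ • (z.2 + t • h.2)))
      (nhdsWithin 0 (Set.Ioi 0)) (nhds ((1 : ℝ), ‖z.2‖⁻¹ • z.2)) :=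
    tendsto_const_nhds.prodMk_nhds ((hc0.norm.inv₀ hpos.ne').smul hc0)
  have hmain := (((hlim.const_add h.1).div_const 2).max
    (tendsto_const_nhds (x := (0 : ℝ)))).smul hvec
  refine hmain.congr' ?_
  have hev : ∀ᶠ t : ℝ in nhdsWithin 0 (Set.Ioi 0), z.1 + t * h.1 < ‖z.2 + t • h.2‖ :=
    hc1.eventually_lt hc0.norm (by linarith)
  filter_upwards [hev, self_mem_nhdsWithin] with t ht ht0
  have ht0 : 0 < t := ht0
  rw [hPz, sub_zero, hP]
  simp only [Prod.fst_add, Prod.snd_add, Prod.smul_fst, Prod.smul_snd, smul_eq_mul]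
  rw [if_neg (not_le.mpr ht)]
  have e : (h.1 + t⁻¹ * (‖z.2 + t • h.2‖ - ‖z.2‖)) / 2
      = t⁻¹ * ((z.1 + t * h.1 + ‖z.2 + t • h.2‖) / 2) := by
    rw [hz1]; field_simp; ring
  rw [e]
  split_ifs with hle
  · rw [max_eq_right, zero_smul, smul_zero]
    exact mul_nonpos_of_nonneg_of_nonpos (inv_pos.mpr ht0).le (by linarith)
  · rw [max_eq_left, smul_smul]
    exact mul_nonneg (inv_pos.mpr ht0).le (by linarith)
end

section
/- Let n ≥ 1, E = EuclideanSpace ℝ (Fin n), and let P : ℝ × E → ℝ × E be the metric projection onto the second-order cone K = {(z₁, z₂) : ‖z₂‖ ≤ z₁}, given by P(z) = z if ‖z₂‖ ≤ z₁; P(z) = 0 if z₁ ≤ −‖z₂‖; and P(z) = ((z₁ + ‖z₂‖)/2) • (1, z₂/‖z₂‖) otherwise. Then for every z = (z₁, z₂) with |z₁| = ‖z₂‖ (i.e. z on the boundary of K or of −K, including z = 0), P is not Fréchet differentiable at z: there is no continuous linear map A : ℝ × E → ℝ × E with ‖P(z + h) − P(z) − A h‖/‖h‖ → 0 as h → 0.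 -/
open Filter Topology in
theorem slopes_eq_aux (g : ℝ → ℝ) (c k a b : ℝ) (hg : HasDerivAt g c 0)
    (ha : ∀ᶠ t in 𝓝 (0 : ℝ), 0 ≤ t → g t = k + a * t)
    (hb : ∀ᶠ t in 𝓝 (0 : ℝ), t ≤ 0 → g t = k + b * t) : a = b := by
  have hl : ∀ a : ℝ, HasDerivAt (fun t : ℝ => k + a * t) a 0 := fun a => by
    simpa using ((hasDerivAt_id (0 : ℝ)).const_mul a).const_add k
  have h1 : c = a := by
    have e : HasDerivWithinAt g a (Set.Ici 0) 0 :=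
      (hl a).hasDerivWithinAt.congr_of_eventuallyEq
        (eventually_nhdsWithin_iff.2 ha) (ha.self_of_nhds le_rfl)
    exact (uniqueDiffWithinAt_Ici (0 : ℝ)).eq_deriv _ hg.hasDerivWithinAt e
  have h2 : c = b := by
    have e : HasDerivWithinAt g b (Set.Iic 0) 0 :=
      (hl b).hasDerivWithinAt.congr_of_eventuallyEq
        (eventually_nhdsWithin_iff.2 hb) (hb.self_of_nhds le_rfl)
    exact (uniqueDiffWithinAt_Iic (0 : ℝ)).eq_deriv _ hg.hasDerivWithinAt e
  exact h1.symm.trans h2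

/-- The metric projection onto the second-order cone is not Fréchet differentiable at any
point `z` with `|z₁| = ‖z₂‖`, i.e. at any point on the boundary of `K` or of `−K`
(including the origin). -/
theorem metric_projection_secondOrderCone_not_fderiv_boundary
    (n : ℕ) (hn : 1 ≤ n)
    (P : ℝ × EuclideanSpace ℝ (Fin n) → ℝ × EuclideanSpace ℝ (Fin n))
    (hP : ∀ z, P z =
      if ‖z.2‖ ≤ z.1 then z
      else if z.1 ≤ -‖z.2‖ then 0
      else ((z.1 + ‖z.2‖) / 2) • ((1 : ℝ), ‖z.2‖⁻¹ • z.2))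
    (z : ℝ × EuclideanSpace ℝ (Fin n)) (hz : |z.1| = ‖z.2‖) :
    ¬ ∃ A : ℝ × EuclideanSpace ℝ (Fin n) →L[ℝ] ℝ × EuclideanSpace ℝ (Fin n),
      HasFDerivAt P A z := by
  rintro ⟨A, hA⟩
  obtain ⟨x, y⟩ := z
  simp only at hz
  have hg : ∃ c, HasDerivAt (fun t : ℝ => (P (x + t, y)).1) c 0 := by
    have hline : HasDerivAt (fun t : ℝ => (x + t, y)) ((1 : ℝ), 0) 0 :=
      ((hasDerivAt_id (0 : ℝ)).const_add x).prodMk (hasDerivAt_const (0 : ℝ) y)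
    have hA' : HasFDerivAt P A ((fun t : ℝ => (x + t, y)) 0) := by simpa using hA
    have h := hA'.comp_hasDerivAt (0 : ℝ) hline
    exact ⟨_, (hasFDerivAt_fst (𝕜 := ℝ)).comp_hasDerivAt (0 : ℝ) h⟩
  obtain ⟨c, hc⟩ := hg
  have hval : ∀ t : ℝ, (P (x + t, y)).1 =
      if ‖y‖ ≤ x + t then x + t else if x + t ≤ -‖y‖ then 0 else (x + t + ‖y‖) / 2 := by
    intro t
    rw [hP]
    dsimp only
    split_ifs <;> simp
  simp only [hval] at hc
  have hy := norm_nonneg y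
  generalize ‖y‖ = r at *
  rcases hy.eq_or_lt with h0 | hpos
  · subst h0
    have hx : x = 0 := abs_eq_zero.1 hz
    subst hx
    have := slopes_eq_aux _ c 0 1 0 hc
      (.of_forall fun t ht => by split_ifs <;> grind)
      (.of_forall fun t ht => by split_ifs <;> grind)
    norm_num at this
  · have hs : ∀ᶠ t in nhds (0 : ℝ), -r < t ∧ t < r :=
      Ioo_mem_nhds (by linarith) hpos
    rcases (abs_eq hy).1 hz with h | h
    · subst h
      have := slopes_eq_aux _ c x 1 (1 / 2) hc
        (hs.mono fun t h ht => by split_ifs <;> grind)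
        (hs.mono fun t h ht => by split_ifs <;> grind)
      norm_num at this
    · subst h
      have := slopes_eq_aux _ c 0 (1 / 2) 0 hc
        (hs.mono fun t h ht => by split_ifs <;> grind)
        (hs.mono fun t h ht => by split_ifs <;> grind)
      norm_num at this
end
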